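/- Let a ∈ ℝ with a ∉ [−1, 1/3], and let {H_m(z)} be the sequence of polynomials defined by H_0 = 1, H_1 = −1, H_2 = 1 − a, and H_{m+3}(z) + H_{m+2}(z) + a·H_{m+1}(z) + z·H_m(z) = 0 for m ≥ 0. Then there exists M ∈ ℕ such that for all m ≥ M the polynomial H_m(z) has a zero that is not real; in particular, not all H_m are hyperbolic. -/

import Mathlib

open Polynomial
open Filter Topology

lemma auxA (P : ℝ[X]) (h : ∀ z : ℂ, aeval z P = 0 → z.im = 0) (z : ℂ) :
    ‖aeval (z.re : ℂ) P‖ ≤ ‖aeval z P‖ := by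
  have key : ∀ w : ℂ, aeval w P = (P.map (algebraMap ℝ ℂ)).leadingCoeff *
      ((P.map (algebraMap ℝ ℂ)).roots.map (fun r => w - r)).prod := by
    intro w
    rw [aeval_def, ← eval_map]
    have hs := IsAlgClosed.splits (P.map (algebraMap ℝ ℂ))
    exact hs.eval_eq_prod_roots w
  rw [key, key, norm_mul, norm_mul]
  refine mul_le_mul_of_nonneg_left ?_ (norm_nonneg _)
  have hr : ∀ r ∈ (P.map (algebraMap ℝ ℂ)).roots, r.im = 0 := by
    intro r hr
    apply h
    have := (mem_roots'.1 hr).2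
    rwa [IsRoot.def, eval_map, ← aeval_def] at this
  revert hr
  generalize (P.map (algebraMap ℝ ℂ)).roots = s
  induction s using Multiset.induction_on with
  | empty => simp
  | cons r s ih =>
    intro hr
    simp only [Multiset.map_cons, Multiset.prod_cons, norm_mul]
    refine mul_le_mul ?_ (ih fun t ht => hr t (Multiset.mem_cons_of_mem ht)) (norm_nonneg _) (norm_nonneg _)
    have h1 : (z.re : ℂ) - r = (((z - r).re : ℝ) : ℂ) := by
      apply Complex.ext <;> simp [hr r (Multiset.mem_cons_self _ _)]
    rw [h1, Complex.norm_real]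
    exact Complex.abs_re_le_norm _

lemma auxB (a : ℝ) (H : ℕ → Polynomial ℝ)
    (h0 : H 0 = 1) (h1 : H 1 = C (-1)) (h2 : H 2 = C (1 - a))
    (hrec : ∀ m, H (m + 3) + H (m + 2) + C a * H (m + 1) + X * H m = 0)
    (z u v w : ℂ) (huv : u - v ≠ 0) (huw : u - w ≠ 0) (hvw : v - w ≠ 0)
    (hu : u^3+u^2+a*u+z=0) (hv : v^3+v^2+a*v+z=0) (hw : w^3+w^2+a*w+z=0) (m : ℕ) :
    aeval z (H m) = u^2/((u-v)*(u-w)) * u^m + v^2/((v-u)*(v-w)) * v^m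
      + w^2/((w-u)*(w-v)) * w^m := by
  have e1 : u^2+u*v+v^2+u+v+a = 0 := by
    apply mul_left_cancel₀ huv; linear_combination hu - hv
  have e2 : u^2+u*w+w^2+u+w+a = 0 := by
    apply mul_left_cancel₀ huw; linear_combination hu - hw
  have e3 : u+v+w+1 = 0 := by
    apply mul_left_cancel₀ hvw; linear_combination e1 - e2
  have hw' : w = -1-u-v := by linear_combination e3
  have ha' : (a:ℂ) = -(u^2+u*v+v^2+u+v) := by linear_combination e1
  have huv' : v - u ≠ 0 := fun h => huv (by linear_combination -h)
  have huw' : w - u ≠ 0 := fun h => huw (by linear_combination -h)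
  have hvw' : w - v ≠ 0 := fun h => hvw (by linear_combination -h)
  have key : ∀ m, aeval z (H m) = u^2/((u-v)*(u-w)) * u^m + v^2/((v-u)*(v-w)) * v^m
      + w^2/((w-u)*(w-v)) * w^m ∧ aeval z (H (m+1)) = u^2/((u-v)*(u-w)) * u^(m+1) + v^2/((v-u)*(v-w)) * v^(m+1)
      + w^2/((w-u)*(w-v)) * w^(m+1) ∧ aeval z (H (m+2)) = u^2/((u-v)*(u-w)) * u^(m+2) + v^2/((v-u)*(v-w)) * v^(m+2)
      + w^2/((w-u)*(w-v)) * w^(m+2) := by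
    intro m
    induction m with
    | zero =>
      simp only [zero_add, h0, h1, h2, map_one, aeval_C, map_neg, map_sub, Complex.coe_algebraMap]
      rw [show v - u = -(u-v) by ring, show w - u = -(u-w) by ring, show w - v = -(v-w) by ring]
      refine ⟨?_, ?_, ?_⟩
      · field_simp
        ring
      · field_simp
        rw [hw']; ring
      · field_simp
        rw [ha', hw']; ring
    | succ n ih =>
      obtain ⟨i0, i1, i2⟩ := ih
      refine ⟨i1, i2, ?_⟩
      have := congrArg (aeval z) (hrec n)
      simp only [map_add, map_mul, aeval_C, aeval_X, map_zero, Complex.coe_algebraMap] at this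
      rw [i0, i1, i2] at this
      have e : n + 1 + 2 = n + 3 := rfl
      rw [e]
      linear_combination this - u^2/((u-v)*(u-w)) * u^n * hu - v^2/((v-u)*(v-w)) * v^n * hv
        - w^2/((w-u)*(w-v)) * w^n * hw
  exact (key m).1

lemma auxC (a u z0 : ℂ) (hz : u^3+u^2+a*u+z0=0) (hd : 3*u^2+2*u+a ≠ 0) :
    ∃ g : ℂ → ℂ, g z0 = u ∧ (∀ᶠ z in 𝓝 z0, (g z)^3+(g z)^2+a*(g z)+z=0) ∧
      HasDerivAt g (-(3*u^2+2*u+a))⁻¹ z0 := by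
  let q : ℂ → ℂ := fun u => -(u^3+u^2+a*u)
  have hq : HasStrictDerivAt q (-(3*u^2+2*u+a)) u := by
    have := ((((hasStrictDerivAt_id u).pow 3).add ((hasStrictDerivAt_id u).pow 2)).add
      ((hasStrictDerivAt_id u).const_mul a)).neg
    have e : -(3*u^2+2*u+a) = -(((3:ℕ):ℂ) * id u ^ (3 - 1) * 1 + ((2:ℕ):ℂ) * id u ^ (2 - 1) * 1 + a * 1) := by
      simp
    rw [e]
    exact this
  have hqz : q u = z0 := by simp only [q]; linear_combination -hz
  have hd' : -(3*u^2+2*u+a) ≠ 0 := neg_ne_zero.2 hd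
  refine ⟨hq.localInverse q _ u hd', ?_, ?_, ?_⟩
  · rw [← hqz]
    exact (hq.hasStrictFDerivAt_equiv hd').localInverse_apply_image
  · rw [← hqz]
    filter_upwards [(hq.hasStrictFDerivAt_equiv hd').eventually_right_inverse] with z hz
    have : q (hq.localInverse q _ u hd' z) = z := hz
    simp only [q] at this ⊢
    linear_combination -this
  · rw [← hqz]
    exact (hq.to_localInverse hd').hasDerivAt

lemma auxD (g : ℂ → ℂ) (g' z0 u ζ : ℂ) (hu : u ≠ 0) (h0 : g z0 = u) (hg : HasDerivAt g g' z0) :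
    Tendsto (fun m : ℕ => (g (z0 + ζ / m) / u) ^ m) atTop (𝓝 (Complex.exp (g' / u * ζ))) := by
  have h1 : HasDerivAt (fun t : ℂ => g (z0 + ζ * t) / u) (g' * ζ / u) 0 := by
    have h2 : HasDerivAt (fun t : ℂ => z0 + ζ * t) ζ 0 := by
      simpa using ((hasDerivAt_id (0:ℂ)).const_mul ζ).const_add z0
    have h3 : HasDerivAt g g' (z0 + ζ * 0) := by simpa using hg
    exact (h3.comp (0:ℂ) h2).div_const u
  have h4 : Tendsto (fun m : ℕ => ((m:ℂ))⁻¹) atTop (𝓝[≠] 0) := by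
    rw [tendsto_nhdsWithin_iff]
    refine ⟨tendsto_inv_atTop_nhds_zero_nat, ?_⟩
    · filter_upwards [eventually_gt_atTop 0] with m hm
      simp; omega
  have h5 := (hasDerivAt_iff_tendsto_slope_zero.1 h1).comp h4
  have h6 := Complex.tendsto_one_add_pow_exp_of_tendsto (g := fun m : ℕ => g (z0 + ζ / m) / u - 1)
    (t := g' / u * ζ) ?_
  · simpa using h6
  · convert h5 using 2
    · simp [h0, hu, div_eq_mul_inv]
    · ring

lemma auxF (B : ℝ) (c l : ℂ) (hB : B ≠ 0) (hc : c ≠ 0) (hp : l.re ≠ 0) (hq : l.im ≠ 0)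
    (h : ∀ z : ℂ, ‖(B:ℂ) + c * Complex.exp (l * z.re) + (starRingEnd ℂ) c * Complex.exp ((starRingEnd ℂ) l * z.re)‖
      ≤ ‖(B:ℂ) + c * Complex.exp (l * z) + (starRingEnd ℂ) c * Complex.exp ((starRingEnd ℂ) l * z)‖) : False := by
  set E := Complex.exp (l * Complex.I) with hE
  set E' := Complex.exp (-(l * Complex.I)) with hE'
  -- linear inequality
  have key : ∀ x0 : ℝ, 0 ≤ B * (c * Complex.exp (l * x0) * (E + E' - 2)).re := by
    intro x0
    set d := c * Complex.exp (l * x0) with hd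
    -- inequality with r
    have h1 : ∀ r : ℝ, 0 < r → ∀ k : ℤ, r = Real.exp (l.re * (2 * Real.pi * k / l.im)) →
        0 ≤ 2 * B * (d * (E + E' - 2)).re
          + r * (‖d * E + (starRingEnd ℂ) (d * E')‖^2 - (2 * d.re)^2) := by
      intro r hr k hk
      have hx : Complex.exp (l * ((x0 + 2 * Real.pi * k / l.im : ℝ) : ℂ)) = Complex.exp (l * x0) * r := by
        have : l * ((x0 + 2 * Real.pi * k / l.im : ℝ) : ℂ) = l * x0 + ((l.re * (2 * Real.pi * k / l.im) : ℝ) : ℂ) + k * (2 * Real.pi * Complex.I) := by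
          apply Complex.ext
          · simp
            try ring
          · simp
            field_simp
            try ring
        rw [this, Complex.exp_add, Complex.exp_add, Complex.exp_int_mul_two_pi_mul_I, hk, Complex.ofReal_exp]
        ring
      set x := x0 + 2 * Real.pi * k / l.im
      have hx' : Complex.exp ((starRingEnd ℂ) l * (x : ℂ)) = (starRingEnd ℂ) (Complex.exp (l * x0)) * r := by
        have := congrArg (starRingEnd ℂ) hx
        rw [← Complex.exp_conj] at this
        simpa using this
      have hh := h (x + Complex.I)
      have e1 : ((x:ℂ) + Complex.I).re = x := by simp
      have e2 : (starRingEnd ℂ) l * Complex.I = (starRingEnd ℂ) (-(l * Complex.I)) := by simp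
      rw [e1, mul_add, mul_add, Complex.exp_add, Complex.exp_add, hx, hx', e2, Complex.exp_conj, ← hE, ← hE'] at hh
      have hh2 := pow_le_pow_left₀ (norm_nonneg _) hh 2
      have f1 : (B:ℂ) + c * (Complex.exp (l * x0) * r) + (starRingEnd ℂ) c * ((starRingEnd ℂ) (Complex.exp (l * x0)) * r)
        = ((B + r * (2 * d.re) : ℝ) : ℂ) := by
        have : d + (starRingEnd ℂ) d = ((2 * d.re : ℝ):ℂ) := Complex.add_conj d
        push_cast at this ⊢
        rw [← this, hd, map_mul]; ring
      have f2 : (B:ℂ) + c * (Complex.exp (l * x0) * r * E) + (starRingEnd ℂ) c * ((starRingEnd ℂ) (Complex.exp (l * x0)) * r * (starRingEnd ℂ) E')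
        = B + r * (d * E + (starRingEnd ℂ) (d * E')) := by
        rw [hd, map_mul, map_mul]; ring
      rw [f1, f2, ← Complex.normSq_eq_norm_sq, ← Complex.normSq_eq_norm_sq] at hh2
      rw [← Complex.normSq_eq_norm_sq]
      simp only [Complex.normSq_apply] at hh2 ⊢
      simp at hh2 ⊢
      refine nonneg_of_mul_nonneg_right ?_ hr
      nlinarith [hh2]
    -- take limit
    have h2 : ∃ r : ℕ → ℝ, Tendsto r atTop (𝓝 0) ∧ ∀ n, 0 < r n ∧ ∃ k : ℤ, r n = Real.exp (l.re * (2 * Real.pi * k / l.im)) := by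
      have hpi := Real.pi_pos
      rcases lt_or_gt_of_ne (div_ne_zero hp hq) with hs | hs
      · refine ⟨fun n => Real.exp (l.re / l.im * (2 * Real.pi) * n), ?_, fun n => ⟨Real.exp_pos _, n, ?_⟩⟩
        · refine Real.tendsto_exp_atBot.comp ?_
          exact tendsto_natCast_atTop_atTop.const_mul_atTop_of_neg (by nlinarith)
        · push_cast; ring_nf
      · refine ⟨fun n => Real.exp (-(l.re / l.im * (2 * Real.pi)) * n), ?_, fun n => ⟨Real.exp_pos _, -n, ?_⟩⟩
        · refine Real.tendsto_exp_atBot.comp ?_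
          exact tendsto_natCast_atTop_atTop.const_mul_atTop_of_neg (by nlinarith)
        · push_cast; ring_nf
    obtain ⟨r, hr, hr'⟩ := h2
    have h3 : Tendsto (fun n => 2 * B * (d * (E + E' - 2)).re
          + r n * (‖d * E + (starRingEnd ℂ) (d * E')‖^2 - (2 * d.re)^2)) atTop
          (𝓝 (2 * B * (d * (E + E' - 2)).re
          + 0 * (‖d * E + (starRingEnd ℂ) (d * E')‖^2 - (2 * d.re)^2))) :=
      (hr.mul_const _).const_add _
    have h4 := ge_of_tendsto' h3 (fun n => by
      obtain ⟨hn, k, hk⟩ := hr' n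
      exact h1 _ hn k hk)
    linarith
  set K := c * (E + E' - 2) with hK
  have phase : ∀ t : ℝ, ∃ ρ : ℝ, 0 < ρ ∧ Complex.exp (l * ((t / l.im : ℝ):ℂ)) = ρ * Complex.exp (t * Complex.I) := by
    intro t
    refine ⟨Real.exp (l.re * (t / l.im)), Real.exp_pos _, ?_⟩
    rw [Complex.ofReal_exp, ← Complex.exp_add]
    congr 1
    apply Complex.ext
    · simp
    · simp
      field_simp
  have key2 : ∀ t : ℝ, 0 ≤ B * (K * Complex.exp (t * Complex.I)).re := by
    intro t
    obtain ⟨ρ, hρ, he⟩ := phase t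
    have := key (t / l.im)
    rw [he] at this
    have e : c * (ρ * Complex.exp (t * Complex.I)) * (E + E' - 2) = ρ * (K * Complex.exp (t * Complex.I)) := by
      rw [hK]; ring
    rw [e, Complex.re_ofReal_mul] at this
    refine (mul_nonneg_iff_of_pos_left hρ).1 ?_
    linarith
  have k0 := key2 0
  have k1 := key2 Real.pi
  have k2 := key2 (Real.pi / 2)
  have k3 := key2 (-(Real.pi / 2))
  have ei : Complex.exp (((Real.pi / 2 : ℝ) : ℂ) * Complex.I) = Complex.I := by
    push_cast; exact Complex.exp_pi_div_two_mul_I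
  have ei' : Complex.exp (((-(Real.pi / 2) : ℝ) : ℂ) * Complex.I) = -Complex.I := by
    push_cast; rw [← neg_div]; exact Complex.exp_neg_pi_div_two_mul_I
  rw [Complex.exp_pi_mul_I] at k1
  rw [ei] at k2
  rw [ei'] at k3
  simp at k0 k1 k2 k3
  have hre : K.re = 0 := by
    have : B * K.re = 0 := le_antisymm k1 k0
    exact (mul_eq_zero.1 this).resolve_left hB
  have him : K.im = 0 := by
    have : B * K.im = 0 := le_antisymm k2 k3
    exact (mul_eq_zero.1 this).resolve_left hB
  have hK0 : K = 0 := Complex.ext hre him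
  have hEE : E + E' - 2 = 0 := (mul_eq_zero.1 hK0).resolve_left hc
  have hEE1 : E * E' = 1 := by rw [hE, hE', ← Complex.exp_add]; simp
  have hE1 : E = 1 := by
    have : (E - 1)^2 = 0 := by linear_combination E * hEE - hEE1
    have := pow_eq_zero_iff (two_ne_zero) |>.1 this
    linear_combination this
  have hn := congrArg norm hE1
  rw [hE, Complex.norm_exp] at hn
  simp at hn
  exact hq hn

theorem stmt_19 (a : ℝ) (ha : a ∉ Set.Icc (-1 : ℝ) (1 / 3)) (H : ℕ → Polynomial ℝ)
    (h0 : H 0 = 1) (h1 : H 1 = C (-1)) (h2 : H 2 = C (1 - a))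
    (hrec : ∀ m, H (m + 3) + H (m + 2) + C a * H (m + 1) + X * H m = 0) :
    ∃ M : ℕ, ∀ m, M ≤ m → ∃ z : ℂ, aeval z (H m) = 0 ∧ z.im ≠ 0 := by
  by_contra! hcon
  have hpos : 0 < (3 * a - 1) * (a + 1) := by
    rw [Set.mem_Icc, not_and_or, not_le, not_le] at ha
    rcases ha with h | h <;> nlinarith
  have ha0 : a ≠ 0 := by
    rintro rfl; norm_num at ha
  have h3a : 3 * a - 1 ≠ 0 := fun h => by rw [h] at hpos; simp at hpos
  obtain ⟨s, hs0, hs⟩ : ∃ s : ℝ, 0 < s ∧ 4 * s^2 = (3 * a - 1) * (a + 1) := by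
    refine ⟨Real.sqrt ((3 * a - 1) * (a + 1) / 4), Real.sqrt_pos.2 (by linarith), ?_⟩
    rw [Real.sq_sqrt (by linarith)]; ring
  have hsC : 4 * (s:ℂ)^2 = (3 * a - 1) * (a + 1) := by exact_mod_cast hs
  have haC : (a:ℂ) ≠ 0 := by exact_mod_cast ha0
  have hI := Complex.I_sq
  set u : ℂ := ((-a : ℝ) : ℂ) with hu
  set v : ℂ := (((a - 1) / 2 : ℝ) : ℂ) + s * Complex.I with hv
  set w : ℂ := (starRingEnd ℂ) v with hw
  have huc : (starRingEnd ℂ) u = u := Complex.conj_ofReal _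
  have hwc : (starRingEnd ℂ) w = v := Complex.conj_conj _
  have hu' : u = -a := by rw [hu]; push_cast; ring
  have hv' : v = (a - 1) / 2 + s * Complex.I := by rw [hv]; push_cast; ring
  have hw' : w = (a - 1) / 2 - s * Complex.I := by
    rw [hw, hv, map_add, map_mul, Complex.conj_ofReal, Complex.conj_ofReal, Complex.conj_I]
    push_cast; ring
  have hsum : v + w = a - 1 := by rw [hv', hw']; ring
  have hprod : v * w = a^2 := by
    rw [hv', hw']; linear_combination (-(s:ℂ)^2) * hI + hsC/4
  have hvq : v^2 = (a-1)*v - a^2 := by linear_combination v * hsum - hprod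
  have hwq : w^2 = (a-1)*w - a^2 := by linear_combination w * hsum - hprod
  have hu0 : u ≠ 0 := by rw [hu']; simpa using haC
  have hv0 : v ≠ 0 := by
    intro h; rw [h] at hprod
    exact pow_ne_zero 2 haC (by rw [← hprod]; ring)
  have hw0 : w ≠ 0 := by
    intro h; rw [h] at hprod
    exact pow_ne_zero 2 haC (by rw [← hprod]; ring)
  have hvu : v - u ≠ 0 := by
    intro h; have := congrArg Complex.im h
    simp [hv, hu] at this
    exact hs0.ne' this
  have hwu : w - u ≠ 0 := by
    intro h; have := congrArg Complex.im h
    rw [Complex.sub_im, hw, Complex.conj_im, hv, hu] at this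
    simp at this
    exact hs0.ne' this
  have hvw : v - w ≠ 0 := by
    intro h; have := congrArg Complex.im h
    rw [Complex.sub_im, hw, Complex.conj_im, hv] at this
    simp at this
    exact hs0.ne' this
  have huv : u - v ≠ 0 := fun h => hvu (by linear_combination -h)
  have huw : u - w ≠ 0 := fun h => hwu (by linear_combination -h)
  have hwv : w - v ≠ 0 := fun h => hvw (by linear_combination -h)
  set z0 : ℂ := ((a^3 : ℝ) : ℂ) with hz0
  have hz0' : z0 = (a:ℂ)^3 := by rw [hz0]; push_cast; ring
  have pu : u^3 + u^2 + a * u + z0 = 0 := by rw [hu', hz0']; ring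
  have pv : v^3 + v^2 + a * v + z0 = 0 := by
    rw [hz0']; linear_combination (v + a) * hvq
  have pw : w^3 + w^2 + a * w + z0 = 0 := by
    rw [hz0']; linear_combination (w + a) * hwq
  have du : 3*u^2+2*u+a = (u-v)*(u-w) := by rw [hu']; linear_combination (-a:ℂ) * hsum - hprod
  have dv : 3*v^2+2*v+a = (v-u)*(v-w) := by
    rw [hu']; linear_combination (v + a) * hsum + hvq
  have dw : 3*w^2+2*w+a = (w-u)*(w-v) := by
    rw [hu']; linear_combination (w + a) * hsum + hwq
  obtain ⟨g1, g1z, g1p, g1d⟩ := auxC a u z0 pu (by rw [du]; exact mul_ne_zero huv huw)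
  obtain ⟨g2, g2z, g2p, g2d⟩ := auxC a v z0 pv (by rw [dv]; exact mul_ne_zero hvu hvw)
  obtain ⟨g3, g3z, g3p, g3d⟩ := auxC a w z0 pw (by rw [dw]; exact mul_ne_zero hwu hwv)
  rw [du] at g1d
  rw [dv] at g2d
  rw [dw] at g3d
  -- subsequence
  have hfreq : ∃ᶠ m in atTop, ∀ z : ℂ, aeval z (H m) = 0 → z.im = 0 := by
    rw [frequently_atTop]
    intro M
    obtain ⟨m, hm, hh⟩ := hcon M
    exact ⟨m, hm, hh⟩
  obtain ⟨ψ, hψ, hψr⟩ := extraction_of_frequently_atTop hfreq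
  have hnorm : ‖v / u‖ = 1 := by
    have e1 : ‖v‖^2 = a^2 := by
      rw [← Complex.normSq_eq_norm_sq, ← Complex.ofReal_inj, ← Complex.mul_conj, ← hw, hprod]
      push_cast; ring
    have e2 : ‖u‖ = |a| := by rw [hu, Complex.norm_real]; simp
    have e3 : ‖v‖ = |a| := by
      rw [← abs_of_nonneg (norm_nonneg v)]; exact (sq_eq_sq_iff_abs_eq_abs _ _).1 e1
    rw [norm_div, e2, e3, div_self (abs_ne_zero.2 ha0)]
  obtain ⟨ω, hω, χ, hχ, hlim⟩ := (isCompact_sphere (0:ℂ) 1).tendsto_subseq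
    (x := fun n => (v / u) ^ (ψ n)) (fun n => by
      rw [mem_sphere_zero_iff_norm, norm_pow, hnorm, one_pow])
  set φ := ψ ∘ χ with hφ
  have hφm : StrictMono φ := hψ.comp hχ
  have hω0 : ω ≠ 0 := by
    rintro rfl; simp at hω
  have hlim2 : Tendsto (fun n => (v / u) ^ (φ n)) atTop (𝓝 ω) := hlim
  have hlim3 : Tendsto (fun n => (w / u) ^ (φ n)) atTop (𝓝 ((starRingEnd ℂ) ω)) := by
    have := (Complex.continuous_conj.tendsto ω).comp hlim2
    refine this.congr fun n => ?_
    simp [huc, ← hw]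
  set α1 := (-((u-v)*(u-w)))⁻¹ / u with hα1
  set α2 := (-((v-u)*(v-w)))⁻¹ / v with hα2
  set α3 := (-((w-u)*(w-v)))⁻¹ / w with hα3
  set A1 := u^2/((u-v)*(u-w)) with hA1
  set A2 := v^2/((v-u)*(v-w)) with hA2
  set A3 := w^2/((w-u)*(w-v)) with hA3
  have main : ∀ ζ : ℂ, Tendsto (fun k => aeval (z0 + ζ / (φ k : ℂ)) (H (φ k)) / u ^ (φ k)) atTop
      (𝓝 (A1 * Complex.exp (α1 * ζ) + A2 * (ω * Complex.exp (α2 * ζ)) +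
        A3 * ((starRingEnd ℂ) ω * Complex.exp (α3 * ζ)))) := by
    intro ζ
    have t1 := (auxD g1 _ z0 u ζ hu0 g1z g1d).comp hφm.tendsto_atTop
    have t2 := (auxD g2 _ z0 v ζ hv0 g2z g2d).comp hφm.tendsto_atTop
    have t3 := (auxD g3 _ z0 w ζ hw0 g3z g3d).comp hφm.tendsto_atTop
    have tz : Tendsto (fun k => z0 + ζ / (φ k : ℂ)) atTop (𝓝 z0) := by
      have : Tendsto (fun m : ℕ => z0 + ζ * ((m:ℂ))⁻¹) atTop (𝓝 (z0 + ζ * 0)) :=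
        (tendsto_inv_atTop_nhds_zero_nat.const_mul ζ).const_add z0
      simp only [mul_zero, add_zero] at this
      exact this.comp hφm.tendsto_atTop
    have c1 : Tendsto g1 (𝓝 z0) (𝓝 u) := by
      have := g1d.continuousAt.tendsto; rwa [g1z] at this
    have c2 : Tendsto g2 (𝓝 z0) (𝓝 v) := by
      have := g2d.continuousAt.tendsto; rwa [g2z] at this
    have c3 : Tendsto g3 (𝓝 z0) (𝓝 w) := by
      have := g3d.continuousAt.tendsto; rwa [g3z] at this
    have a1 := (((c1.pow 2).div ((c1.sub c2).mul (c1.sub c3)) (mul_ne_zero huv huw))).comp tz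
    have a2 := (((c2.pow 2).div ((c2.sub c1).mul (c2.sub c3)) (mul_ne_zero hvu hvw))).comp tz
    have a3 := (((c3.pow 2).div ((c3.sub c1).mul (c3.sub c2)) (mul_ne_zero hwu hwv))).comp tz
    have tot := ((a1.mul t1).add (a2.mul (hlim2.mul t2))).add (a3.mul (hlim3.mul t3))
    refine tot.congr' ?_
    have n1 := tz.eventually ((c1.sub c2).eventually_ne huv)
    have n2 := tz.eventually ((c1.sub c3).eventually_ne huw)
    have n3 := tz.eventually ((c2.sub c3).eventually_ne hvw)
    filter_upwards [n1, n2, n3, tz.eventually g1p, tz.eventually g2p, tz.eventually g3p]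
      with k m1 m2 m3 q1 q2 q3
    rw [auxB a H h0 h1 h2 hrec _ _ _ _ m1 m2 m3 q1 q2 q3 (φ k)]
    simp only [Function.comp_apply, Pi.div_apply, Pi.mul_apply, div_pow]
    have := pow_ne_zero (φ k) hu0
    have := pow_ne_zero (φ k) hv0
    have := pow_ne_zero (φ k) hw0
    generalize g1 (z0 + ζ / (φ k : ℂ)) ^ 2 / _ = X1
    generalize g2 (z0 + ζ / (φ k : ℂ)) ^ 2 / _ = X2
    generalize g3 (z0 + ζ / (φ k : ℂ)) ^ 2 / _ = X3
    field_simp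
  have hineq : ∀ ζ : ℂ, ‖A1 * Complex.exp (α1 * ζ.re) + A2 * (ω * Complex.exp (α2 * ζ.re)) +
        A3 * ((starRingEnd ℂ) ω * Complex.exp (α3 * ζ.re))‖ ≤
      ‖A1 * Complex.exp (α1 * ζ) + A2 * (ω * Complex.exp (α2 * ζ)) +
        A3 * ((starRingEnd ℂ) ω * Complex.exp (α3 * ζ))‖ := by
    intro ζ
    refine le_of_tendsto_of_tendsto' (main (ζ.re : ℂ)).norm (main ζ).norm fun k => ?_
    rw [norm_div, norm_div]
    refine div_le_div_of_nonneg_right ?_ (norm_nonneg _)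
    have := auxA (H (φ k)) (hψr (χ k)) (z0 + ζ / (φ k : ℂ))
    have e : (((z0 + ζ / (φ k : ℂ)).re : ℝ) : ℂ) = z0 + (ζ.re : ℂ) / (φ k : ℂ) := by
      rw [Complex.add_re, Complex.div_natCast_re, hz0, Complex.ofReal_re]
      push_cast; ring
    rw [e] at this
    exact this
  -- constants
  have hA3c : A3 = (starRingEnd ℂ) A2 := by
    rw [hA3, hA2]; simp only [map_div₀, map_mul, map_sub, map_pow, huc, hwc, ← hw]
  have hα3c : α3 = (starRingEnd ℂ) α2 := by
    rw [hα3, hα2]; simp only [map_div₀, map_mul, map_sub, map_inv₀, map_neg, huc, hwc, ← hw]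
  have hP : (u-v)*(u-w) = ((a * (3 * a - 1) : ℝ) : ℂ) := by
    rw [hu']; push_cast; linear_combination (a:ℂ) * hsum + hprod
  have hA1r : A1 = ((a / (3 * a - 1) : ℝ) : ℂ) := by
    have : (3 * (a:ℂ) - 1) ≠ 0 := by exact_mod_cast h3a
    rw [hA1, hP, hu']; push_cast; field_simp
  have hα1r : α1 = ((1 / (a^2 * (3 * a - 1)) : ℝ) : ℂ) := by
    have : (3 * (a:ℂ) - 1) ≠ 0 := by exact_mod_cast h3a
    rw [hα1, hP, hu']; push_cast; field_simp
  have hα2' : α2 = (((2 * (2 * a - 1) * s^2 : ℝ) : ℂ) + ((s * (3 * a - 1) : ℝ) : ℂ) * Complex.I)⁻¹ := by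
    rw [hα2, div_eq_mul_inv, ← mul_inv]
    congr 1
    have e : v - w = 2 * s * Complex.I := by rw [hv', hw']; ring
    rw [e, hu']
    have : v * (v + a) = (2 * a - 1) * v - a^2 := by linear_combination hvq
    have e2 : -((v - -(a:ℂ)) * (2 * s * Complex.I)) * v = - (2 * s * Complex.I) * (v * (v + a)) := by ring
    rw [e2, this, hv']
    push_cast
    linear_combination (-2 * (s:ℂ)^2 * (2 * a - 1)) * hI
  have hnsq : Complex.normSq (((2 * (2 * a - 1) * s^2 : ℝ) : ℂ) + ((s * (3 * a - 1) : ℝ) : ℂ) * Complex.I)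
      = 4 * a^3 * s^2 * (3 * a - 1) := by
    rw [Complex.normSq_add_mul_I]
    linear_combination (s^2 * (2 * a - 1)^2) * hs
  have hre : α2.re = (2 * a - 1) / (2 * a^3 * (3 * a - 1)) := by
    rw [hα2', Complex.inv_re, hnsq]
    have := hs0.ne'
    simp only [Complex.add_re, Complex.ofReal_re, Complex.re_ofReal_mul, Complex.I_re, mul_zero, add_zero]
    field_simp
    ring
  have him : α2.im ≠ 0 := by
    rw [hα2', Complex.inv_im, hnsq]
    have := hs0.ne'
    simp only [Complex.add_im, Complex.ofReal_im, Complex.im_ofReal_mul, Complex.I_im, mul_one, zero_add]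
    refine div_ne_zero (neg_ne_zero.2 (mul_ne_zero this h3a)) ?_
    positivity
  refine auxF (a / (3 * a - 1)) (A2 * ω) (α2 - α1) (div_ne_zero ha0 h3a) ?_ ?_ ?_ ?_
  · exact mul_ne_zero (div_ne_zero (pow_ne_zero _ hv0) (mul_ne_zero hvu hvw)) hω0
  · rw [Complex.sub_re, hre, hα1r, Complex.ofReal_re]
    have : (2 * a - 1) / (2 * a^3 * (3 * a - 1)) - 1 / (a^2 * (3 * a - 1)) = - 1 / (2 * a^3 * (3 * a - 1)) := by
      field_simp; ring
    rw [this]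
    refine div_ne_zero (by norm_num) ?_
    positivity
  · rw [Complex.sub_im, hα1r, Complex.ofReal_im, sub_zero]; exact him
  · have hα1c : (starRingEnd ℂ) α1 = α1 := by rw [hα1r]; exact Complex.conj_ofReal _
    have fac : ∀ ζ : ℂ, ((a / (3 * a - 1) : ℝ) : ℂ) + A2 * ω * Complex.exp ((α2 - α1) * ζ) +
        (starRingEnd ℂ) (A2 * ω) * Complex.exp ((starRingEnd ℂ) (α2 - α1) * ζ) =
        Complex.exp (-(α1 * ζ)) * (A1 * Complex.exp (α1 * ζ) + A2 * (ω * Complex.exp (α2 * ζ)) +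
        A3 * ((starRingEnd ℂ) ω * Complex.exp (α3 * ζ))) := by
      intro ζ
      rw [← hA1r, map_mul, map_sub, ← hA3c, ← hα3c, hα1c]
      have x1 : Complex.exp ((α2 - α1) * ζ) = Complex.exp (-(α1 * ζ)) * Complex.exp (α2 * ζ) := by
        rw [← Complex.exp_add]; congr 1; ring
      have x2 : Complex.exp ((α3 - α1) * ζ) = Complex.exp (-(α1 * ζ)) * Complex.exp (α3 * ζ) := by
        rw [← Complex.exp_add]; congr 1; ring
      have x3 : Complex.exp (-(α1 * ζ)) * Complex.exp (α1 * ζ) = 1 := by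
        rw [← Complex.exp_add]; simp
      rw [x1, x2]
      linear_combination (-A1) * x3
    intro ζ
    rw [fac, fac, norm_mul, norm_mul]
    have : ‖Complex.exp (-(α1 * (ζ.re : ℂ)))‖ = ‖Complex.exp (-(α1 * ζ))‖ := by
      rw [Complex.norm_exp, Complex.norm_exp, hα1r]
      simp only [Complex.neg_re, Complex.re_ofReal_mul, Complex.ofReal_re]
    rw [this]
    exact mul_le_mul_of_nonneg_left (hineq ζ) (norm_nonneg _)
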